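/- Let H be a star-forest, i.e., a finite forest each of whose connected components is a star. Then there exists a natural number c such that χ(G) ≤ ω(G)^{c} for every nonempty finite H-free graph G. -/

import Mathlib

open SimpleGraph

/-- `G` has no induced subgraph isomorphic to `H`. -/
def IsInducedSubgraphFree {W V : Type*} (H : SimpleGraph W) (G : SimpleGraph V) : Prop :=
  ¬ ∃ s : Set V, Nonempty (H ≃g G.induce s)

/-- `H` is a star-forest: a forest each of whose connected components is a star,
i.e. each component has a vertex adjacent to all other vertices of the component. -/
def IsStarForest {V : Type*} (H : SimpleGraph V) : Prop :=
  H.IsAcyclic ∧ ∀ C : H.ConnectedComponent, ∃ v, H.connectedComponentMk v = C ∧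
    ∀ w, H.connectedComponentMk w = C → w ≠ v → H.Adj v w

namespace SimpleGraph

open Finset
open scoped Classical

variable {V : Type*} {G : SimpleGraph V} {A B : Finset V} {d k m n : ℕ}

/-- The subgraph of `G` induced on `A` has a proper colouring with `n` colours. -/
def ColorableOn (G : SimpleGraph V) (A : Finset V) (n : ℕ) : Prop :=
  ∃ f : V → ℕ, (∀ x ∈ A, f x < n) ∧ ∀ x ∈ A, ∀ y ∈ A, G.Adj x y → f x ≠ f y

theorem ColorableOn.mono (hBA : B ⊆ A) (hmn : m ≤ n) (h : G.ColorableOn A m) :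
    G.ColorableOn B n := by
  obtain ⟨f, hf, hf'⟩ := h
  exact ⟨f, fun x hx => (hf x (hBA hx)).trans_le hmn,
    fun x hx y hy => hf' x (hBA hx) y (hBA hy)⟩

theorem ColorableOn.union (hA : G.ColorableOn A m) (hB : G.ColorableOn B n) :
    G.ColorableOn (A ∪ B) (m + n) := by
  obtain ⟨f, hf, hf'⟩ := hA
  obtain ⟨g, hg, hg'⟩ := hB
  refine ⟨fun x => if x ∈ A then f x else m + g x, fun x hx => ?_, fun x hx y hy hxy => ?_⟩ <;>
  grind

theorem ColorableOn.biUnion {ι : Type*} {I : Finset ι} {S : ι → Finset V}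
    (h : ∀ i ∈ I, G.ColorableOn (S i) n) : G.ColorableOn (I.biUnion S) (#I * n) := by
  induction I using Finset.induction_on with
  | empty => exact ⟨fun _ => 0, by simp, by simp⟩
  | insert i I hi ih =>
    rw [biUnion_insert, card_insert_of_notMem hi]
    refine ((h i (mem_insert_self i I)).union
      (ih fun j hj => h j (mem_insert_of_mem hj))).mono subset_rfl ?_
    rw [add_mul, one_mul, add_comm]

theorem colorableOn_of_degree_lt (h : ∀ v ∈ A, #{w ∈ A | G.Adj v w} < n) :
    G.ColorableOn A n := by
  induction A using Finset.induction_on with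
  | empty => exact ⟨fun _ => 0, by simp, by simp⟩
  | insert a A ha ih =>
    obtain ⟨f, hf, hf'⟩ := ih fun v hv => lt_of_le_of_lt
      (card_le_card (filter_subset_filter _ (subset_insert a A))) (h v (mem_insert_of_mem hv))
    obtain ⟨c, hc, hc'⟩ : ∃ c ∈ range n, c ∉ image f {w ∈ insert a A | G.Adj a w} := by
      refine exists_mem_notMem_of_card_lt_card ?_
      rw [card_range]
      exact card_image_le.trans_lt (h a (mem_insert_self a A))
    refine ⟨Function.update f a c, fun x hx => ?_, fun x hx y hy hxy => ?_⟩
    · by_cases hxa : x = a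
      · simpa [hxa] using hc
      · simpa [hxa] using hf x ((mem_insert.1 hx).resolve_left hxa)
    · simp only [mem_image, mem_filter, not_exists, not_and] at hc'
      by_cases hxa : x = a <;> by_cases hya : y = a
      · exact absurd hxy (by simp [hxa, hya])
      · subst hxa
        simpa [hya] using fun e => hc' y ⟨hy, hxy⟩ e.symm
      · subst hya
        simpa [hxa] using hc' x ⟨hx, hxy.symm⟩
      · simpa [hxa, hya] using hf' x ((mem_insert.1 hx).resolve_left hxa) y
          ((mem_insert.1 hy).resolve_left hya) hxy

theorem colorableOn_of_card_le (h : #A ≤ n) : G.ColorableOn A n :=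
  colorableOn_of_degree_lt fun v hv => lt_of_lt_of_le
    (card_lt_card ((filter_ssubset).2 ⟨v, hv, G.irrefl⟩)) h

/-- A polynomial Ramsey bound. -/
theorem card_le_of_forall_isIndepSet_card_ne (hcl : ∀ K ⊆ B, G.IsClique (K : Set V) → #K ≤ n)
    (hind : ∀ L ⊆ B, G.IsIndepSet (L : Set V) → #L ≠ d) : #B ≤ (n + 1) ^ (d + 1) := by
  induction d generalizing B with
  | zero => exact absurd rfl (hind ∅ (empty_subset _) (by simp))
  | succ d ih =>
    obtain ⟨K, hK, hmax⟩ := exists_max_image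
      (B.powerset.filter fun K : Finset V => G.IsClique (K : Set V)) card
      ⟨∅, by simp⟩
    simp only [mem_filter, mem_powerset] at hK hmax
    have hcov : B ⊆ K.biUnion fun x => insert x {y ∈ B | y ≠ x ∧ ¬ G.Adj x y} := by
      intro y hy
      by_contra hy'
      simp only [mem_biUnion, mem_insert, mem_filter, not_exists, not_and, not_or] at hy'
      have hyK : y ∉ K := fun hyK => (hy' y hyK).1 rfl
      have := hmax (insert y K) ⟨insert_subset hy hK.1, by
        rw [coe_insert]
        refine hK.2.insert fun b hb hyb => ?_
        have := (hy' b hb).2 hy hyb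
        exact (not_not.1 this).symm⟩
      rw [card_insert_of_notMem hyK] at this
      omega
    have hx : ∀ x ∈ K, #(insert x {y ∈ B | y ≠ x ∧ ¬ G.Adj x y}) ≤ (n + 1) ^ (d + 1) + 1 := by
      intro x hxK
      refine (card_insert_le _ _).trans (Nat.add_le_add_right (ih
        (fun K' hK' => hcl K' (hK'.trans (filter_subset _ _))) fun L hL hLi hLd => ?_) 1)
      have hxL : x ∉ L := fun hxL => (mem_filter.1 (hL hxL)).2.1 rfl
      refine hind (insert x L) (insert_subset (hK.1 hxK) (hL.trans (filter_subset _ _))) ?_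
        (by rw [card_insert_of_notMem hxL, hLd])
      rw [coe_insert]
      refine Set.Pairwise.insert hLi fun b hb _ => ?_
      have := (mem_filter.1 (hL hb)).2.2
      exact ⟨this, fun h => this h.symm⟩
    have h1 := (card_le_card hcov).trans (card_biUnion_le_card_mul _ _ _ hx)
    have h2 : #K * ((n + 1) ^ (d + 1) + 1) ≤ n * ((n + 1) ^ (d + 1) + 1) :=
      Nat.mul_le_mul_right _ (hcl K hK.1 hK.2)
    have h3 : n + 1 ≤ (n + 1) ^ (d + 1) := Nat.le_self_pow (by omega) _
    rw [pow_succ (n + 1) (d + 1)]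
    nlinarith

/-- Either `B` contains `m` disjoint cliques of size `q`, or all its cliques of size `q` can be hit
by few vertices. -/
theorem exists_disjoint_cliques_or_hitting_set (G : SimpleGraph V) (B : Finset V) (m : ℕ) {q : ℕ}
    (hq : 0 < q) :
    (∃ F : Finset (Finset V), #F = m ∧ (F : Set (Finset V)).PairwiseDisjoint id ∧
      ∀ Q ∈ F, Q ⊆ B ∧ G.IsClique (Q : Set V) ∧ #Q = q) ∨
    ∃ T ⊆ B, #T ≤ m * q ∧ ∀ K ⊆ B \ T, G.IsClique (K : Set V) → #K < q := by
  induction m with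
  | zero => exact .inl ⟨∅, by simp⟩
  | succ m ih =>
    obtain ⟨F, hF, hdisj, hFB⟩ | ⟨T, hT, hTc, hTK⟩ := ih
    · have hle : #(F.biUnion id) ≤ m * q := by
        rw [← hF]
        exact card_biUnion_le_card_mul _ _ _ fun Q hQ => (hFB Q hQ).2.2.le
      by_cases h : ∃ K ⊆ B \ F.biUnion id, G.IsClique (K : Set V) ∧ q ≤ #K
      · obtain ⟨K, hKB, hK, hqK⟩ := h
        obtain ⟨Q, hQK, hQ⟩ := exists_subset_card_eq hqK
        have hQd : ∀ R ∈ F, Disjoint Q R := fun R hR => Finset.disjoint_left.2 fun x hxQ hxR =>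
          (mem_sdiff.1 (hKB (hQK hxQ))).2 (mem_biUnion.2 ⟨R, hR, hxR⟩)
        have hQF : Q ∉ F := fun hQF => by
          have := hQd Q hQF
          rw [disjoint_self_iff_empty] at this
          simp [this] at hQ
          omega
        refine .inl ⟨insert Q F, by rw [card_insert_of_notMem hQF, hF], ?_, ?_⟩
        · rw [coe_insert]
          exact hdisj.insert fun R hR _ => hQd R hR
        · intro R hR
          obtain rfl | hR := mem_insert.1 hR
          · exact ⟨(hQK.trans hKB).trans sdiff_subset, hK.subset (by exact_mod_cast hQK), hQ⟩
          · exact hFB R hR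
      · push Not at h
        exact .inr ⟨_, biUnion_subset.2 fun Q hQ => (hFB Q hQ).1,
          hle.trans (Nat.mul_le_mul_right _ (Nat.le_succ m)), h⟩
    · exact .inr ⟨T, hT, hTc.trans (Nat.mul_le_mul_right _ (Nat.le_succ m)), hTK⟩

theorem exists_disjoint_of_card_lt {F : Finset (Finset V)}
    (hF : (F : Set (Finset V)).PairwiseDisjoint id) (h : #B < #F) : ∃ Q ∈ F, Disjoint Q B := by
  by_contra! hmeet
  have hmeet' : ∀ Q ∈ F, ∃ x ∈ B, x ∈ Q := fun Q hQ => by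
    obtain ⟨x, hxQ, hxB⟩ := not_disjoint_iff.1 (hmeet Q hQ)
    exact ⟨x, hxB, hxQ⟩
  have : Nonempty V := by
    obtain ⟨Q, hQ⟩ := card_pos.1 ((Nat.zero_le _).trans_lt h)
    exact ⟨(hmeet' Q hQ).choose⟩
  choose! g hgB hgQ using hmeet'
  refine h.not_ge (card_le_card_of_injOn g hgB fun Q hQ R hR hQR => ?_)
  by_contra hne
  exact Finset.disjoint_left.1 (hF hQ hR hne) (hgQ Q hQ) (hQR ▸ hgQ R hR)

/-- `G.HasInducedStars d k A` says that `A` contains `k` pairwise anticomplete induced stars, each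
with `d` leaves. -/
inductive HasInducedStars (G : SimpleGraph V) (d : ℕ) : ℕ → Finset V → Prop
  | zero (A : Finset V) : HasInducedStars G d 0 A
  | succ {k : ℕ} {A B L : Finset V} {v : V} (hv : v ∈ A) (hLA : L ⊆ A) (hLd : #L = d)
      (hL : G.IsIndepSet (L : Set V)) (hvL : ∀ x ∈ L, G.Adj v x) (hBA : B ⊆ A)
      (hvB : ∀ b ∈ B, b ≠ v ∧ ¬ G.Adj v b) (hLB : ∀ x ∈ L, ∀ b ∈ B, ¬ G.Adj x b)
      (hB : HasInducedStars G d k B) : HasInducedStars G d (k + 1) A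

theorem HasInducedStars.mono (hAB : A ⊆ B) (h : G.HasInducedStars d k A) :
    G.HasInducedStars d k B := by
  cases h with
  | zero => exact .zero B
  | succ hv hLA hLd hL hvL hBA hvB hLB hB =>
    exact .succ (hAB hv) (hLA.trans hAB) hLd hL hvL (hBA.trans hAB) hvB hLB hB

/-- One step of the decomposition: a vertex `v` of large degree lets us split `A`, up to a part of
small chromatic number, into two parts whose clique numbers add up to at most `ω(A)`. -/
theorem exists_split_of_degree_ge {N x c : ℕ} (hxN : x ≤ N)
    (hcl : ∀ K ⊆ A, G.IsClique (K : Set V) → #K ≤ x)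
    (hk : ¬ G.HasInducedStars d (k + 1) A)
    (hcol : ∀ B ⊆ A, ¬ G.HasInducedStars d k B → G.ColorableOn B c)
    {v : V} (hv : v ∈ A) (hdeg : (N + 1) ^ (d + 2) ≤ #{w ∈ A | G.Adj v w}) :
    ∃ q, 0 < q ∧ q < x ∧ ∃ A₁ ⊆ A, ∃ A₂ ⊆ A, ∃ A₃,
      A ⊆ A₁ ∪ A₂ ∪ A₃ ∧ (∀ K ⊆ A₁, G.IsClique (K : Set V) → #K ≤ q) ∧
      (∀ K ⊆ A₂, G.IsClique (K : Set V) → #K ≤ x - q) ∧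
      G.ColorableOn A₃ (1 + (N + 1) ^ (d + 3) + (N + 1) ^ ((d + 3) * d) * c) := by
  set M := (N + 1) ^ (d + 2) with hM
  set D : Finset V := {w ∈ A | G.Adj v w}
  have hDA : D ⊆ A := filter_subset _ _
  have hDcl : ∀ K ⊆ D, G.IsClique (K : Set V) → #K + 1 ≤ x := by
    intro K hK hKc
    have hvK : v ∉ K := fun h => G.irrefl (mem_filter.1 (hK h)).2
    rw [← card_insert_of_notMem hvK]
    refine hcl _ (insert_subset hv (hK.trans hDA)) ?_
    rw [coe_insert]
    exact hKc.insert fun b hb _ => (mem_filter.1 (hK hb)).2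
  let P : ℕ → Prop := fun q => ∃ F : Finset (Finset V), #F = M ∧
    (F : Set (Finset V)).PairwiseDisjoint id ∧ ∀ Q ∈ F, Q ⊆ D ∧ G.IsClique (Q : Set V) ∧ #Q = q
  have hM0 : 0 < M := by positivity
  have hPlt : ∀ q, P q → q < x := by
    rintro q ⟨F, hF, -, hFD⟩
    obtain ⟨Q, hQ⟩ := card_pos.1 (hF ▸ hM0)
    obtain ⟨h1, h2, h3⟩ := hFD Q hQ
    have := hDcl Q h1 h2
    omega
  have hP1 : P 1 := by
    obtain ⟨D', hD', hD'c⟩ := exists_subset_card_eq hdeg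
    refine ⟨D'.image fun w => {w}, ?_, ?_, ?_⟩
    · rw [card_image_of_injective _ singleton_injective, hD'c]
    · intro Q hQ R hR hQR
      simp only [coe_image, Set.mem_image] at hQ hR
      obtain ⟨a, -, rfl⟩ := hQ
      obtain ⟨b, -, rfl⟩ := hR
      simpa [Function.onFun] using fun h : a = b => hQR (by rw [h])
    · intro Q hQ
      obtain ⟨a, ha, rfl⟩ := mem_image.1 hQ
      exact ⟨by simpa using hD' ha, by simp, by simp⟩
  have hx1 : 1 < x := hPlt 1 hP1
  obtain ⟨q, hq1, hPq, hPq'⟩ : ∃ q, 1 ≤ q ∧ P q ∧ ¬ P (q + 1) := by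
    have h1 := Nat.findGreatest_spec hx1.le hP1
    refine ⟨Nat.findGreatest P x, Nat.le_findGreatest hx1.le hP1, h1, fun h => ?_⟩
    have := Nat.le_findGreatest (hPlt _ h).le h
    omega
  have hqx := hPlt q hPq
  obtain ⟨F, hF, hdisj, hFD⟩ := hPq
  obtain ⟨T, hTD, hTc, hTK⟩ :=
    (exists_disjoint_cliques_or_hitting_set G D M (Nat.succ_pos q)).resolve_left hPq'
  set S := F.biUnion id
  have hSD : S ⊆ D := biUnion_subset.2 fun Q hQ => (hFD Q hQ).1
  have hMN : M * (N + 1) = (N + 1) ^ (d + 3) := by rw [hM, ← pow_succ]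
  have hSc : #S ≤ (N + 1) ^ (d + 3) := by
    refine (card_biUnion_le_card_mul _ _ q fun Q hQ => (hFD Q hQ).2.2.le).trans ?_
    rw [hF, ← hMN]
    exact Nat.mul_le_mul_left _ (by omega)
  set I : Finset (Finset V) := {L ∈ S.powersetCard d | G.IsIndepSet (L : Set V)} with hI
  let W₀ : Finset V := {w ∈ A | w ≠ v ∧ ¬ G.Adj v w}
  let W : Finset V → Finset V := fun L => {w ∈ W₀ | ∀ y ∈ L, ¬ G.Adj y w}
  have hIc : #I ≤ (N + 1) ^ ((d + 3) * d) := by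
    refine (card_filter_le _ _).trans ?_
    rw [card_powersetCard, pow_mul]
    exact (Nat.choose_le_pow _ _).trans (Nat.pow_le_pow_left hSc d)
  have hWcol : G.ColorableOn (I.biUnion W) (#I * c) := by
    refine ColorableOn.biUnion fun L hL => ?_
    simp only [hI, mem_filter, mem_powersetCard] at hL
    obtain ⟨⟨hLS, hLd⟩, hLi⟩ := hL
    have hWA : W L ⊆ A := (filter_subset _ _).trans (filter_subset _ _)
    refine hcol _ hWA fun hst => hk (.succ hv ((hLS.trans hSD).trans hDA) hLd hLi
      (fun y hy => (mem_filter.1 (hSD (hLS hy))).2) hWA (fun b hb => ?_) (fun y hy b hb => ?_) hst)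
    · exact (mem_filter.1 (mem_filter.1 hb).1).2
    · exact (mem_filter.1 hb).2 y hy
  refine ⟨q, hq1, hqx, D \ T, sdiff_subset.trans hDA, W₀ \ I.biUnion W,
    sdiff_subset.trans (filter_subset _ _), {v} ∪ T ∪ I.biUnion W, ?_, ?_, ?_, ?_⟩
  · intro w hw
    simp only [mem_union, mem_sdiff, mem_singleton]
    by_cases hwv : w = v
    · tauto
    · by_cases hvw : G.Adj v w
      · have : w ∈ D := mem_filter.2 ⟨hw, hvw⟩
        tauto
      · have : w ∈ W₀ := mem_filter.2 ⟨hw, hwv, hvw⟩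
        tauto
  · exact fun K hK hKc => Nat.lt_succ_iff.1 (hTK K hK hKc)
  · intro K hK hKc
    have hKA : K ⊆ A := (hK.trans sdiff_subset).trans (filter_subset _ _)
    set X := K.biUnion fun w => {y ∈ S | ¬ G.Adj w y}
    have hXc : #X < #F := by
      have h1 : #X ≤ #K * (N + 1) ^ (d + 1) := by
        refine card_biUnion_le_card_mul _ _ _ fun w hw => card_le_of_forall_isIndepSet_card_ne
          (fun K' hK' hK'c => (hcl K' (hK'.trans ((filter_subset _ _).trans
            (hSD.trans hDA))) hK'c).trans hxN) fun L hL hLi hLd => ?_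
        have hw' := mem_sdiff.1 (hK hw)
        refine hw'.2 (mem_biUnion.2 ⟨L, ?_, mem_filter.2 ⟨hw'.1, fun y hy h => ?_⟩⟩)
        · exact mem_filter.2 ⟨mem_powersetCard.2 ⟨hL.trans (filter_subset _ _), hLd⟩, hLi⟩
        · exact (mem_filter.1 (hL hy)).2 h.symm
      have h2 : #K ≤ N := (hcl K hKA hKc).trans hxN
      rw [hF]
      calc #X ≤ #K * (N + 1) ^ (d + 1) := h1
        _ ≤ N * (N + 1) ^ (d + 1) := Nat.mul_le_mul_right _ h2
        _ < (N + 1) * (N + 1) ^ (d + 1) := Nat.mul_lt_mul_of_pos_right (by omega) (by positivity)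
        _ = M := by rw [hM, pow_succ' (N + 1) (d + 1)]
    obtain ⟨Q, hQF, hQX⟩ := exists_disjoint_of_card_lt hdisj hXc
    obtain ⟨hQD, hQc, hQq⟩ := hFD Q hQF
    have hKQ : ∀ w ∈ K, ∀ y ∈ Q, G.Adj w y := by
      intro w hw y hy
      by_contra h
      exact Finset.disjoint_left.1 hQX hy (mem_biUnion.2
        ⟨w, hw, mem_filter.2 ⟨mem_biUnion.2 ⟨Q, hQF, hy⟩, h⟩⟩)
    have hKQd : Disjoint K Q := Finset.disjoint_left.2 fun w hw hw' => G.irrefl (hKQ w hw w hw')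
    have := hcl (K ∪ Q) (union_subset hKA (hQD.trans hDA)) (by
      rw [coe_union, isClique_iff, Set.pairwise_union]
      exact ⟨hKc, hQc, fun a ha b hb _ => ⟨hKQ a ha b hb, (hKQ a ha b hb).symm⟩⟩)
    rw [card_union_of_disjoint hKQd] at this
    omega
  · have hT : #T ≤ (N + 1) ^ (d + 3) :=
      hTc.trans (hMN ▸ Nat.mul_le_mul_left _ (by omega))
    exact (((colorableOn_of_card_le (card_singleton v).le).union
      (colorableOn_of_card_le hT)).union hWcol).mono subset_rfl
        (Nat.add_le_add_left (Nat.mul_le_mul_right _ hIc) _)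

/-- Graphs without `k` anticomplete induced stars have chromatic number polynomial in the clique
number. -/
theorem exists_colorableOn_of_not_hasInducedStars (d k : ℕ) :
    ∃ c : ℕ, ∀ {V : Type*} (G : SimpleGraph V) (A : Finset V) (N : ℕ), 0 < N →
      (∀ K ⊆ A, G.IsClique (K : Set V) → #K ≤ N) → ¬ G.HasInducedStars d k A →
      G.ColorableOn A ((N + 1) ^ c) := by
  induction k with
  | zero => exact ⟨0, fun G A N _ _ h => absurd (.zero A) h⟩
  | succ k ih =>
    obtain ⟨c, hc⟩ := ih
    set e := (d + 3) * (d + 1) + c with he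
    refine ⟨e + 4, fun {V} G A N hN hcl hk => ?_⟩
    have hpow : ∀ {a b : ℕ}, a ≤ b → (N + 1) ^ a ≤ (N + 1) ^ b :=
      Nat.pow_le_pow_right (Nat.succ_pos N)
    set E := (N + 1) ^ (e + 2) with hE
    have hEbound : 1 + (N + 1) ^ (d + 3) + (N + 1) ^ ((d + 3) * d) * (N + 1) ^ c ≤ E := by
      have h1 : 1 ≤ (N + 1) ^ e := Nat.one_le_pow _ _ (Nat.succ_pos N)
      have h2 : (N + 1) ^ (d + 3) ≤ (N + 1) ^ e := hpow (by rw [he]; nlinarith)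
      have h3 : (N + 1) ^ ((d + 3) * d) * (N + 1) ^ c ≤ (N + 1) ^ e := by
        rw [← pow_add]
        exact hpow (by rw [he]; nlinarith)
      have h4 : E = (N + 1) ^ e * ((N + 1) * (N + 1)) := by rw [hE, pow_add, sq]
      have h5 : 4 ≤ (N + 1) * (N + 1) := by nlinarith
      rw [h4]
      nlinarith
    have key : ∀ y < N, ∀ B ⊆ A, (∀ K ⊆ B, G.IsClique (K : Set V) → #K ≤ y + 1) →
        G.ColorableOn B ((2 * y + 1) * E) := by
      intro y
      induction y using Nat.strong_induction_on with
      | _ y ihy =>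
      intro hyN B hBA hBcl
      by_cases hdeg : ∀ v ∈ B, #{w ∈ B | G.Adj v w} < (N + 1) ^ (d + 2)
      · refine (colorableOn_of_degree_lt hdeg).mono subset_rfl ?_
        have : (N + 1) ^ (d + 2) ≤ E := hpow (by rw [he]; nlinarith)
        nlinarith
      · push Not at hdeg
        obtain ⟨v, hv, hdeg⟩ := hdeg
        obtain ⟨q, hq0, hqx, A₁, hA₁, A₂, hA₂, A₃, hcov, hcl₁, hcl₂, hcol₃⟩ :=
          exists_split_of_degree_ge (c := (N + 1) ^ c) (Nat.succ_le_of_lt hyN) hBcl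
            (fun h => hk (h.mono hBA))
            (fun C hC h => hc G C N hN (fun K hK => hcl K (hK.trans (hC.trans hBA))) h) hv hdeg
        have h₁ := ihy (q - 1) (by omega) (by omega) A₁ (hA₁.trans hBA)
          fun K hK hKc => (hcl₁ K hK hKc).trans (by omega)
        have h₂ := ihy (y - q) (by omega) (by omega) A₂ (hA₂.trans hBA)
          fun K hK hKc => (hcl₂ K hK hKc).trans (by omega)
        refine ((h₁.union h₂).union (hcol₃.mono subset_rfl hEbound)).mono hcov ?_
        obtain ⟨a, rfl⟩ := Nat.exists_eq_add_of_le' hq0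
        obtain ⟨b, rfl⟩ := Nat.exists_eq_add_of_le (Nat.lt_succ_iff.1 hqx)
        simp only [Nat.add_sub_cancel, Nat.add_sub_cancel_left]
        exact le_of_eq (by ring)
    obtain ⟨y, rfl⟩ := Nat.exists_eq_add_of_le' hN
    refine (key y (Nat.lt_succ_self y) A subset_rfl hcl).mono subset_rfl ?_
    have h4 : (y + 1 + 1) ^ (e + 4) = ((y + 1 + 1) * (y + 1 + 1)) * E := by
      rw [hE]; ring
    rw [h4]
    exact Nat.mul_le_mul_right _ (by nlinarith)

theorem _root_.IsStarForest.exists_map_of_hasInducedStars [Nonempty V] {W : Type*} [Fintype W]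
    {H : SimpleGraph W} (hH : IsStarForest H) (𝒞 : Finset H.ConnectedComponent)
    (h : G.HasInducedStars (Fintype.card W) (#𝒞) A) :
    ∃ f : W → V, ∀ x, H.connectedComponentMk x ∈ 𝒞 → f x ∈ A ∧
      ∀ y, H.connectedComponentMk y ∈ 𝒞 → (f x = f y → x = y) ∧ (G.Adj (f x) (f y) ↔ H.Adj x y) := by
  induction 𝒞 using Finset.induction_on generalizing A with
  | empty => exact ⟨fun _ => Classical.arbitrary V, by simp⟩
  | insert C 𝒞 hC ih =>
    rw [card_insert_of_notMem hC] at h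
    cases h with
    | @succ _ _ B L v hv hLA hLd hL hvL hBA hvB hLB hB =>
    obtain ⟨f, hf⟩ := ih hB
    obtain ⟨v₀, hv₀, hv₀C⟩ := hH.2 C
    let g : W ≃ L := Fintype.equivOfCardEq (by simp [hLd])
    have hg : ∀ x, (g x : V) ∈ L := fun x => (g x).2
    have hginj : ∀ x y, (g x : V) = g y → x = y := fun x y h => g.injective (Subtype.ext h)
    have hgind : ∀ x y, ¬ G.Adj (g x) (g y) := fun x y h => hL (hg x) (hg y) h.ne h
    have hleaf : ∀ x y, H.connectedComponentMk x = C → H.connectedComponentMk y = C →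
        x ≠ v₀ → y ≠ v₀ → ¬ H.Adj x y := fun x y hx hy hxv hyv hxy =>
      hH.1.cliqueFree le_rfl {v₀, x, y}
        (is3Clique_triple_iff.2 ⟨hv₀C x hx hxv, hv₀C y hy hyv, hxy⟩)
    have hcomp : ∀ x y, H.Adj x y → H.connectedComponentMk x = H.connectedComponentMk y :=
      fun x y h => ConnectedComponent.connectedComponentMk_eq_of_adj h
    refine ⟨fun x => if H.connectedComponentMk x = C then if x = v₀ then v else g x else f x,
      fun x hx => ⟨?_, fun y hy => ?_⟩⟩
    · grind
    · rw [mem_insert] at hx hy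
      have hvg : ∀ u, v ≠ g u := fun u => (hvL _ (hg u)).ne
      have hgB : ∀ u, ∀ b ∈ B, (g u : V) ≠ b := fun u b hb h => (hvB b hb).2 (h ▸ hvL _ (hg u))
      by_cases hxC : H.connectedComponentMk x = C <;> by_cases hyC : H.connectedComponentMk y = C
      · by_cases hxv : x = v₀ <;> by_cases hyv : y = v₀
        · simp [hxv, hyv]
        · simp only [hyC, hxv, hyv, if_true, if_false, hv₀]
          exact ⟨fun h => absurd h (hvg y), iff_of_true (hvL _ (hg y)) (hv₀C y hyC hyv)⟩
        · simp only [hxC, hxv, hyv, if_true, if_false, hv₀]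
          exact ⟨fun h => absurd h.symm (hvg x),
            iff_of_true (hvL _ (hg x)).symm (hv₀C x hxC hxv).symm⟩
        · simp only [hxC, hyC, hxv, hyv, if_true, if_false]
          exact ⟨hginj x y, iff_of_false (hgind x y) (hleaf x y hxC hyC hxv hyv)⟩
      · have hfy := (hf y (hy.resolve_left hyC)).1
        have hxy : ¬ H.Adj x y := fun h => hyC ((hcomp x y h).symm.trans hxC)
        simp only [hxC, hyC, if_true, if_false]
        split_ifs
        · exact ⟨fun h => absurd h.symm (hvB _ hfy).1, iff_of_false (hvB _ hfy).2 hxy⟩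
        · exact ⟨fun h => absurd h (hgB x _ hfy), iff_of_false (hLB _ (hg x) _ hfy) hxy⟩
      · have hfx := (hf x (hx.resolve_left hxC)).1
        have hxy : ¬ H.Adj x y := fun h => hxC ((hcomp x y h).trans hyC)
        simp only [hxC, hyC, if_true, if_false]
        split_ifs
        · exact ⟨fun h => absurd h (hvB _ hfx).1,
            iff_of_false (fun h => (hvB _ hfx).2 h.symm) hxy⟩
        · exact ⟨fun h => absurd h.symm (hgB y _ hfx),
            iff_of_false (fun h => hLB _ (hg y) _ hfx h.symm) hxy⟩
      · simp only [hxC, hyC, if_false]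
        exact (hf x (hx.resolve_left hxC)).2 y (hy.resolve_left hyC)

end SimpleGraph

theorem stmt_4 {VH : Type} [Fintype VH] (H : SimpleGraph VH) (hH : IsStarForest H) :
    ∃ c : ℕ, ∀ (V : Type) [Fintype V] (G : SimpleGraph V), Nonempty V →
      IsInducedSubgraphFree H G → G.chromaticNumber ≤ (G.cliqueNum ^ c : ℕ) := by
  classical
  obtain ⟨c, hc⟩ := exists_colorableOn_of_not_hasInducedStars (Fintype.card VH)
    (Fintype.card H.ConnectedComponent)
  refine ⟨2 * c, fun V _ G _ hfree => ?_⟩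
  have hcl : ∀ K : Finset V, G.IsClique (K : Set V) → K.card ≤ G.cliqueNum :=
    fun K hK => IsClique.card_le_cliqueNum (tc := hK)
  have v := Classical.arbitrary V
  have hpos : 0 < G.cliqueNum := by simpa [Nat.succ_le_iff] using hcl {v} (by simp)
  rw [chromaticNumber_le_iff_colorable]
  obtain h1 | h2 : G.cliqueNum = 1 ∨ 2 ≤ G.cliqueNum := by omega
  · rw [h1, one_pow]
    refine ⟨Coloring.mk (fun _ => 0) fun {a b} hab => ?_⟩
    have := hcl {a, b} (by simp [hab])
    rw [Finset.card_pair hab.ne] at this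
    omega
  · obtain ⟨f, hf, hf'⟩ := hc G Finset.univ G.cliqueNum hpos (fun K _ => hcl K) fun h => by
      obtain ⟨f, hf⟩ := hH.exists_map_of_hasInducedStars Finset.univ h
      let φ : H ↪g G := ⟨⟨f, fun x y hxy => ((hf x (by simp)).2 y (by simp)).1 hxy⟩,
        fun {x y} => ((hf x (by simp)).2 y (by simp)).2⟩
      exact hfree ⟨Set.range φ, ⟨φ.isoInduceRange⟩⟩
    have hcol : G.Colorable ((G.cliqueNum + 1) ^ c) :=
      ⟨Coloring.mk (fun x => ⟨f x, hf x (by simp)⟩) fun {a b} hab h =>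
        hf' a (by simp) b (by simp) hab (by simpa using h)⟩
    refine hcol.mono ?_
    rw [pow_mul]
    exact Nat.pow_le_pow_left (by nlinarith) c
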